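/- Let α_1,...,α_8 be a normal basis of 𝔽_{q^8} over 𝔽_q and P_i = [1 : α_i : α_i³]. For each i, the determinant of the 10×10 matrix obtained from the singularity-condition matrix M_i by removing its last row equals ± α_i³ · (2α_i + Σ_{j≠i} α_j) · ∏_{j≠i} (α_i − α_j)² · ∏_{k<j, k,j≠i} (α_k − α_j), which is nonzero; hence M_i has trivial kernel and no plane cubic through all eight points P_1,...,P_8 is singular at P_i. -/

import Mathlib

section

variable {K : Type*} [Field K]

/-- Row of the cubic-condition matrix corresponding to the point `[1 : a : a³]`:
the monomials `(x³, y³, z³, x²y, x²z, xy², y²z, xz², yz², xyz)` evaluated there. -/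
def ptRow (a : K) : Fin 10 → K :=
  ![1, a ^ 3, a ^ 9, a, a ^ 3, a ^ 2, a ^ 5, a ^ 6, a ^ 7, a ^ 4]

/-- The `∂/∂x` row of the singularity condition at `[1 : a : a³]`. -/
def dxRow (a : K) : Fin 10 → K :=
  ![3, 0, 0, 2 * a, 2 * a ^ 3, a ^ 2, 0, a ^ 6, 0, a ^ 4]

/-- The `∂/∂y` row of the singularity condition at `[1 : a : a³]`. -/
def dyRow (a : K) : Fin 10 → K :=
  ![0, 3 * a ^ 2, 0, 1, 0, 2 * a, 2 * a ^ 4, 0, a ^ 6, a ^ 3]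

/-- The `∂/∂z` row of the singularity condition at `[1 : a : a³]`. -/
def dzRow (a : K) : Fin 10 → K :=
  ![0, 0, 3 * a ^ 6, 0, 1, 0, a ^ 2, 2 * a ^ 3, 2 * a ^ 4, a]

/-- The 11×10 singularity-condition matrix `M_i` for the points `P_j = [1 : α_j : α_j³]`:
rows `0,…,7` say a cubic passes through `P_j`, and the last three rows say its partial
derivatives vanish at `P_i`. -/
def Mmat (α : Fin 8 → K) (i : Fin 8) : Matrix (Fin 11) (Fin 10) K :=
  Matrix.of fun r : Fin 11 =>
    if hr : (r : ℕ) < 8 then ptRow (α ⟨r, hr⟩)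
    else if (r : ℕ) = 8 then dxRow (α i)
    else if (r : ℕ) = 9 then dyRow (α i)
    else dzRow (α i)

/-- The 10×10 matrix obtained from `M_i` by removing its last row. -/
def Nmat (α : Fin 8 → K) (i : Fin 8) : Matrix (Fin 10) (Fin 10) K :=
  Matrix.of fun r : Fin 10 =>
    if hr : (r : ℕ) < 8 then ptRow (α ⟨r, hr⟩)
    else if (r : ℕ) = 8 then dxRow (α i)
    else dyRow (α i)

/-- The claimed value (up to sign) of the determinant of `N_i`. -/
def detExpr (α : Fin 8 → K) (i : Fin 8) : K :=
  α i ^ 3 * (2 * α i + ∑ j ∈ Finset.univ.filter (fun j : Fin 8 => j ≠ i), α j) *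
    (∏ j ∈ Finset.univ.filter (fun j : Fin 8 => j ≠ i), (α i - α j) ^ 2) *
    (∏ p ∈ Finset.univ.filter
        (fun p : Fin 8 × Fin 8 => p.1 < p.2 ∧ p.1 ≠ i ∧ p.2 ≠ i),
      (α p.1 - α p.2))

end

section Helpers

variable {K : Type*} [Field K]

open Polynomial in
/-- The coefficient data of `(X + ∑ α) ∏ (X - α j)`. -/
theorem exists_coeffs (α : Fin 8 → K) (i : Fin 8) :
    ∃ g : Fin 8 → K,
      (∀ j, (∑ k : Fin 8, α j ^ (k : ℕ) * g k) + α j ^ 9 = 0) ∧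
      (∑ k : Fin 8, g k * ((k : ℕ) : K) * α i ^ ((k : ℕ) - 1)) + 9 * α i ^ 8 =
        (∏ j ∈ Finset.univ.filter (fun j : Fin 8 => j ≠ i), (α i - α j)) *
          (α i + ∑ j, α j) := by
  classical
  set f : K[X] := ∏ j : Fin 8, (X - C (α j)) with hf
  set g : K[X] := f * (X + C (∑ j, α j)) with hg
  have hfm : f.Monic := monic_prod_of_monic _ _ fun j _ => monic_X_sub_C _
  have hfd : f.natDegree = 8 := by
    rw [hf, natDegree_prod_of_monic _ _ (fun j _ => monic_X_sub_C _)]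
    simp
  have hf7 : f.coeff 7 = - ∑ j, α j := by
    have := prod_X_sub_C_coeff_card_pred (Finset.univ : Finset (Fin 8)) α (by simp)
    simpa using this
  have hf8 : f.coeff 8 = 1 := by
    have := hfm.coeff_natDegree
    rwa [hfd] at this
  have hf9 : f.coeff 9 = 0 := coeff_eq_zero_of_natDegree_lt (by omega)
  have hg8 : g.coeff 8 = 0 := by
    rw [hg, mul_add, coeff_add, coeff_mul_X, coeff_mul_C, hf7, hf8]; ring
  have hg9 : g.coeff 9 = 1 := by
    rw [hg, mul_add, coeff_add, coeff_mul_X, coeff_mul_C, hf8, hf9]; ring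
  have hgd : g.natDegree < 10 := by
    refine lt_of_le_of_lt natDegree_mul_le ?_
    rw [hfd, natDegree_X_add_C]; norm_num
  refine ⟨fun k => g.coeff k, fun j => ?_, ?_⟩
  · have h0 : g.eval (α j) = 0 := by
      rw [hg, eval_mul, hf, eval_prod, Finset.prod_eq_zero (Finset.mem_univ j) (by simp), zero_mul]
    rw [eval_eq_sum_range' hgd] at h0
    simp only [Finset.sum_range_succ, Finset.sum_range_zero, hg8, hg9] at h0
    simp only [Fin.sum_univ_eight]
    simp
    linear_combination h0
  · have h1 : (derivative g).eval (α i) =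
        (∏ j ∈ Finset.univ.filter (fun j : Fin 8 => j ≠ i), (α i - α j)) *
          (α i + ∑ j, α j) := by
      have : g = (X - C (α i)) * ((∏ j ∈ Finset.univ.filter (fun j : Fin 8 => j ≠ i),
          (X - C (α j))) * (X + C (∑ j, α j))) := by
        rw [hg, hf, ← mul_assoc]
        congr 1
        rw [Finset.filter_ne', Finset.mul_prod_erase _ (fun j => X - C (α j)) (Finset.mem_univ i)]
      rw [this, derivative_mul]
      simp only [eval_add, eval_mul, eval_prod, eval_sub, eval_X, eval_C, sub_self, zero_mul,
        add_zero, derivative_sub, derivative_X, derivative_C, sub_zero, one_mul]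
    rw [← h1, derivative_eval, sum_over_range' _ (by simp) 10 hgd]
    simp only [Finset.sum_range_succ, Finset.sum_range_zero, hg8, hg9]
    simp only [Fin.sum_univ_eight]
    simp

theorem vandermonde_split (α : Fin 8 → K) (i : Fin 8) :
    (Matrix.vandermonde α).det =
      (∏ j ∈ Finset.univ.filter (fun j : Fin 8 => j ≠ i), (α i - α j)) *
      (∏ p ∈ Finset.univ.filter
        (fun p : Fin 8 × Fin 8 => p.1 < p.2 ∧ p.1 ≠ i ∧ p.2 ≠ i), (α p.1 - α p.2)) ∨
    (Matrix.vandermonde α).det =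
      -((∏ j ∈ Finset.univ.filter (fun j : Fin 8 => j ≠ i), (α i - α j)) *
      (∏ p ∈ Finset.univ.filter
        (fun p : Fin 8 × Fin 8 => p.1 < p.2 ∧ p.1 ≠ i ∧ p.2 ≠ i), (α p.1 - α p.2))) := by
  rw [← sq_eq_sq_iff_eq_or_eq_neg, Matrix.det_vandermonde]
  -- squares of differences form a symmetric function of pairs
  obtain ⟨d, hd⟩ : ∃ d : Fin 8 → Fin 8 → K, ∀ p q, (α p - α q) ^ 2 = d p q := ⟨_, fun _ _ => rfl⟩
  have hsymm : ∀ p q, d p q = d q p := fun p q => by rw [← hd, ← hd]; ring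
  simp only [mul_pow, ← Finset.prod_pow, hd]
  have h1 : ∏ x : Fin 8, ∏ y ∈ Finset.Ioi x, d y x =
      ∏ p ∈ Finset.univ.filter (fun p : Fin 8 × Fin 8 => p.1 < p.2), d p.1 p.2 := by
    rw [Finset.prod_filter, ← Finset.univ_product_univ, Finset.prod_product]
    refine Finset.prod_congr rfl fun x _ => ?_
    rw [← Finset.prod_filter]
    refine Finset.prod_congr (by ext; simp) fun y _ => hsymm _ _
  rw [h1, ← Finset.prod_filter_not_mul_prod_filter (Finset.univ.filter
    (fun p : Fin 8 × Fin 8 => p.1 < p.2)) (fun p => p.1 ≠ i ∧ p.2 ≠ i),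
    Finset.filter_filter, Finset.filter_filter]
  congr 1
  symm
  refine Finset.prod_bij (fun j _ => if i < j then (i, j) else (j, i)) ?_ ?_ ?_ ?_
  · intro j hj
    simp only [Finset.mem_filter, Finset.mem_univ, true_and] at hj ⊢
    split_ifs with h
    · simp [h]
    · simp; omega
  · intro j hj k hk h
    simp only [Finset.mem_filter, Finset.mem_univ, true_and] at hj hk
    split_ifs at h <;> simp_all
  · rintro ⟨p, q⟩ hp
    simp only [Finset.mem_filter, Finset.mem_univ, true_and] at hp
    obtain ⟨hlt, hp⟩ := hp
    by_cases hpi : p = i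
    · subst hpi
      exact ⟨q, by simp; omega, by simp_all⟩
    · have hq : q = i := by tauto
      subst hq
      exact ⟨p, by simpa using hpi, by simp; omega⟩
  · intro j hj
    split_ifs with h
    · rfl
    · exact hsymm _ _

/-- Reordering of the columns: exponents `0,…,7`, then `x²z` and `z³`. -/
def colPerm : Equiv.Perm (Fin 10) where
  toFun := ![0, 3, 5, 1, 9, 6, 7, 8, 4, 2]
  invFun := ![0, 3, 9, 1, 8, 2, 5, 6, 7, 4]
  left_inv := by decide
  right_inv := by decide

theorem det_reorder (M : Matrix (Fin 10) (Fin 10) K) :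
    M.det = (M.submatrix (finSumFinEquiv : Fin 8 ⊕ Fin 2 ≃ Fin 10)
      (fun x => colPerm ((finSumFinEquiv : Fin 8 ⊕ Fin 2 ≃ Fin 10) x))).det ∨
    M.det = -(M.submatrix (finSumFinEquiv : Fin 8 ⊕ Fin 2 ≃ Fin 10)
      (fun x => colPerm ((finSumFinEquiv : Fin 8 ⊕ Fin 2 ≃ Fin 10) x))).det := by
  have h : M.submatrix (finSumFinEquiv : Fin 8 ⊕ Fin 2 ≃ Fin 10)
      (fun x => colPerm ((finSumFinEquiv : Fin 8 ⊕ Fin 2 ≃ Fin 10) x)) =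
      (M.submatrix id colPerm).submatrix (finSumFinEquiv : Fin 8 ⊕ Fin 2 ≃ Fin 10)
        (finSumFinEquiv : Fin 8 ⊕ Fin 2 ≃ Fin 10) := rfl
  rw [h, Matrix.det_submatrix_equiv_self, Matrix.det_permute']
  rcases Int.units_eq_one_or (Equiv.Perm.sign colPerm) with h | h <;> rw [h] <;> simp

theorem det_blocks (α : Fin 8 → K) (i : Fin 8) :
    ((Nmat α i).submatrix (finSumFinEquiv : Fin 8 ⊕ Fin 2 ≃ Fin 10)
      (fun x => colPerm ((finSumFinEquiv : Fin 8 ⊕ Fin 2 ≃ Fin 10) x))).det =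
    (Matrix.vandermonde α).det * (- (α i ^ 3 *
      ((∏ j ∈ Finset.univ.filter (fun j : Fin 8 => j ≠ i), (α i - α j)) *
          (α i + ∑ j, α j)))) := by
  obtain ⟨g, hg0, hg1⟩ := exists_coeffs α i
  rw [← hg1]
  have hgi := hg0 i
  set a := α i with ha
  have hN : (Nmat α i).submatrix (finSumFinEquiv : Fin 8 ⊕ Fin 2 ≃ Fin 10)
      (fun x => colPerm ((finSumFinEquiv : Fin 8 ⊕ Fin 2 ≃ Fin 10) x)) =
      Matrix.fromBlocks (Matrix.vandermonde α) (Matrix.of fun j => ![α j ^ 3, α j ^ 9])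
        !![3, 2 * a, a ^ 2, 0, a ^ 4, 0, a ^ 6, 0; 0, 1, 2 * a, 3 * a ^ 2, a ^ 3, 2 * a ^ 4, 0, a ^ 6]
        !![2 * a ^ 3, 0; 0, 0] := by
    have hcl : ∀ c : Fin 8, colPerm ((finSumFinEquiv : Fin 8 ⊕ Fin 2 ≃ Fin 10) (Sum.inl c)) =
        (![0, 3, 5, 1, 9, 6, 7, 8] : Fin 8 → Fin 10) c := by decide
    have hcr : ∀ c : Fin 2, colPerm ((finSumFinEquiv : Fin 8 ⊕ Fin 2 ≃ Fin 10) (Sum.inr c)) =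
        (![4, 2] : Fin 2 → Fin 10) c := by decide
    have hrl : ∀ r : Fin 8, Nmat α i ((finSumFinEquiv : Fin 8 ⊕ Fin 2 ≃ Fin 10) (Sum.inl r)) =
        ptRow (α r) := fun r => dif_pos r.2
    have hr0 : Nmat α i ((finSumFinEquiv : Fin 8 ⊕ Fin 2 ≃ Fin 10) (Sum.inr 0)) =
        dxRow (α i) := rfl
    have hr1 : Nmat α i ((finSumFinEquiv : Fin 8 ⊕ Fin 2 ≃ Fin 10) (Sum.inr 1)) =
        dyRow (α i) := rfl
    ext r c
    rw [Matrix.submatrix_apply]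
    rcases r with r | r <;> rcases c with c | c
    · rw [hrl, hcl]
      fin_cases c <;> simp [ptRow, Matrix.vandermonde_apply]
    · rw [hrl, hcr]
      fin_cases c <;> simp [ptRow]
    · rw [hcl]
      fin_cases r
      · erw [hr0]
        fin_cases c <;> simp [dxRow, ha]
      · erw [hr1]
        fin_cases c <;> simp [dyRow, ha]
    · rw [hcr]
      fin_cases r
      · erw [hr0]
        fin_cases c <;> simp [dxRow, ha]
      · erw [hr1]
        fin_cases c <;> simp [dyRow, ha]
  let U : Matrix (Fin 8) (Fin 2) K := Matrix.of fun k => ![if k = 3 then -1 else 0, g k]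
  have hU : (Matrix.fromBlocks (1 : Matrix (Fin 8) (Fin 8) K) U 0
      (1 : Matrix (Fin 2) (Fin 2) K)).det = 1 := by simp
  rw [hN]
  refine (mul_one (Matrix.det _)).symm.trans ?_
  refine (congrArg (_ * ·) hU.symm).trans ?_
  rw [← Matrix.det_mul, Matrix.fromBlocks_multiply]
  have hz : Matrix.vandermonde α * U +
      (Matrix.of fun j => ![α j ^ 3, α j ^ 9] : Matrix (Fin 8) (Fin 2) K) *
        (1 : Matrix (Fin 2) (Fin 2) K) = 0 := by
    ext j c
    rw [Matrix.mul_one]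
    fin_cases c
    · simp [Matrix.mul_apply, U, Matrix.vandermonde_apply]
    · simpa [Matrix.mul_apply, U, Matrix.vandermonde_apply] using hg0 j
  rw [hz, Matrix.det_fromBlocks_zero₁₂, Matrix.mul_one, Matrix.mul_zero, add_zero, Matrix.mul_one]
  congr 1
  rw [Matrix.det_fin_two]
  have hU0 : ∀ k, U k 0 = if k = 3 then -1 else 0 := fun k => rfl
  have hU1 : ∀ k, U k 1 = g k := fun k => rfl
  simp only [Matrix.add_apply, Matrix.mul_apply, Fin.sum_univ_eight, hU0, hU1] at hgi ⊢
  clear_value U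
  simp at hgi ⊢
  linear_combination (9 * a ^ 2) * hgi

theorem det_N (α : Fin 8 → K) (i : Fin 8) :
    (Nmat α i).det = detExpr α i ∨ (Nmat α i).det = - detExpr α i := by
  have hsum : α i + ∑ j, α j =
      2 * α i + ∑ j ∈ Finset.univ.filter (fun j : Fin 8 => j ≠ i), α j := by
    rw [Finset.filter_ne', ← Finset.add_sum_erase _ _ (Finset.mem_univ i)]; ring
  have hb := det_blocks α i
  rw [hsum] at hb
  unfold detExpr
  rw [Finset.prod_pow]
  rcases det_reorder (Nmat α i) with h | h <;> rcases vandermonde_split α i with h' | h' <;>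
    rw [h, hb, h']
  · right; ring
  · left; ring
  · left; ring
  · right; ring

/-- Exponent vectors of the ten cubic monomials in the order of the columns. -/
noncomputable def expo (k : Fin 10) : Fin 3 →₀ ℕ :=
  Finsupp.equivFunOnFinite.symm
    ((![![3, 0, 0], ![0, 3, 0], ![0, 0, 3], ![2, 1, 0], ![2, 0, 1], ![1, 2, 0], ![0, 2, 1],
      ![1, 0, 2], ![0, 1, 2], ![1, 1, 1]] : Fin 10 → Fin 3 → ℕ) k)

theorem expo_injective : Function.Injective expo := by
  intro a b h
  replace h := Finsupp.equivFunOnFinite.symm.injective h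
  revert a b
  decide

theorem exists_expo (d : Fin 3 →₀ ℕ) (hd : d 0 + d 1 + d 2 = 3) : ∃ k, expo k = d := by
  have h0 : d 0 ≤ 3 := by omega
  have h1 : d 1 ≤ 3 := by omega
  have h2 : d 2 = 3 - d 0 - d 1 := by omega
  have key : ∀ v : Fin 3 → ℕ, v = ![d 0, d 1, d 2] →
      Finsupp.equivFunOnFinite.symm v = d := by
    rintro v rfl
    ext m
    fin_cases m <;> simp
  have fin : ∀ x y : Fin 4, (x : ℕ) + y ≤ 3 → ∃ k : Fin 10,
      (![![3, 0, 0], ![0, 3, 0], ![0, 0, 3], ![2, 1, 0], ![2, 0, 1], ![1, 2, 0], ![0, 2, 1],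
      ![1, 0, 2], ![0, 1, 2], ![1, 1, 1]] : Fin 10 → Fin 3 → ℕ) k =
        ![(x : ℕ), y, 3 - x - y] := by decide
  obtain ⟨k, hk⟩ := fin ⟨d 0, by omega⟩ ⟨d 1, by omega⟩ (by simp; omega)
  refine ⟨k, key _ ?_⟩
  rw [hk, h2]

theorem cubic_expand (Γ : MvPolynomial (Fin 3) K) (h : Γ.IsHomogeneous 3) :
    Γ = ∑ k : Fin 10, MvPolynomial.monomial (expo k) (Γ.coeff (expo k)) := by
  classical
  ext d
  simp only [MvPolynomial.coeff_sum, MvPolynomial.coeff_monomial]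
  by_cases hk : ∃ k, expo k = d
  · obtain ⟨k, rfl⟩ := hk
    rw [Finset.sum_eq_single k]
    · simp
    · intro b _ hb
      rw [if_neg]
      exact fun h => hb (expo_injective h)
    · simp
  · rw [Finset.sum_eq_zero]
    · by_contra hne
      apply hk
      apply exists_expo
      have := h hne
      simp [Finsupp.weight_apply, Finsupp.sum_fintype, Fin.sum_univ_three] at this
      exact this
    · intro k _
      rw [if_neg]
      exact fun h => hk ⟨k, h⟩

theorem eval_mono (x : Fin 3 → K) (s : Fin 3 →₀ ℕ) (a : K) :
    MvPolynomial.eval x (MvPolynomial.monomial s a) =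
      a * (x 0 ^ s 0 * x 1 ^ s 1 * x 2 ^ s 2) := by
  rw [MvPolynomial.eval_monomial, Finsupp.prod_fintype _ _ (by simp), Fin.prod_univ_three]

theorem kernel_of_cubic (α : Fin 8 → K) (i : Fin 8) (Γ : MvPolynomial (Fin 3) K)
    (h : Γ.IsHomogeneous 3)
    (hp : ∀ j : Fin 8, MvPolynomial.eval ![1, α j, α j ^ 3] Γ = 0)
    (hs : ∀ m : Fin 3, MvPolynomial.eval ![1, α i, α i ^ 3] (MvPolynomial.pderiv m Γ) = 0) :
    (Mmat α i).mulVec (fun k => Γ.coeff (expo k)) = 0 := by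
  have hexp := cubic_expand Γ h
  generalize hc : (fun k => Γ.coeff (expo k)) = c
  have hc' : ∀ k, Γ.coeff (expo k) = c k := fun k => by rw [← hc]
  simp only [hc'] at hexp
  rw [hexp] at hp hs
  simp only [map_sum, MvPolynomial.pderiv_monomial] at hp hs
  have hp' : ∀ j, ∑ k : Fin 10, c k * ((1 : K) ^ expo k 0 * α j ^ expo k 1 *
      (α j ^ 3) ^ expo k 2) = 0 := by
    intro j
    rw [← hp j]
    exact Finset.sum_congr rfl fun k _ => (eval_mono ![1, α j, α j ^ 3] (expo k) (c k)).symm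
  have hs' : ∀ m, ∑ k : Fin 10, c k * (expo k m : K) *
      ((1 : K) ^ (expo k 0 - Finsupp.single m 1 0) * α i ^ (expo k 1 - Finsupp.single m 1 1) *
      (α i ^ 3) ^ (expo k 2 - Finsupp.single m 1 2)) = 0 := by
    intro m
    rw [← hs m]
    exact Finset.sum_congr rfl fun k _ => (eval_mono ![1, α i, α i ^ 3]
      (expo k - Finsupp.single m 1) (c k * (expo k m : K))).symm
  clear hp hs
  rename' hp' => hp, hs' => hs
  simp only [Fin.sum_univ_succ] at hp hs
  have h0 := hs 0
  have h1 := hs 1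
  have h2 := hs 2
  clear hs hexp hc hc'
  simp [expo] at hp h0 h1 h2
  ext r
  by_cases hr : (r : ℕ) < 8
  · have := hp ⟨r, hr⟩
    simp [Matrix.mulVec, dotProduct, Mmat, hr, ptRow, Fin.sum_univ_succ]
    linear_combination this
  · obtain rfl | rfl | rfl : r = 8 ∨ r = 9 ∨ r = 10 := by omega
    · simp [Matrix.mulVec, dotProduct, Mmat, dxRow, Fin.sum_univ_succ]
      linear_combination h0
    · simp [Matrix.mulVec, dotProduct, Mmat, dyRow, Fin.sum_univ_succ]
      linear_combination h1
    · simp [Matrix.mulVec, dotProduct, Mmat, dzRow, Fin.sum_univ_succ]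
      linear_combination h2

theorem detExpr_ne_zero {F : Type*} [Field F] [Algebra F K] (α : Fin 8 → K)
    (hb : LinearIndependent F α) (i : Fin 8) : detExpr α i ≠ 0 := by
  have hinj := hb.injective
  have hd : ∀ p q, p ≠ q → α p - α q ≠ 0 := fun p q h => sub_ne_zero.2 (hinj.ne h)
  unfold detExpr
  refine mul_ne_zero (mul_ne_zero (mul_ne_zero (pow_ne_zero _ (hb.ne_zero i)) ?_) ?_) ?_
  · intro h
    have hz : ∑ j, (if j = i then (2 : F) else 1) • α j = 0 := by
      rw [← Finset.add_sum_erase _ _ (Finset.mem_univ i), ← h, ← Finset.filter_ne']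
      congr 1
      · rw [if_pos rfl, two_smul, two_mul]
      · refine Finset.sum_congr rfl fun j hj => ?_
        simp only [Finset.mem_filter, Finset.mem_univ, true_and] at hj
        simp [hj]
    have := Fintype.linearIndependent_iff.1 hb _ hz (i + 1)
    have hne : i + 1 ≠ i := by clear * -; revert i; decide
    simp [hne] at this
  · refine Finset.prod_ne_zero_iff.2 fun j hj => pow_ne_zero _ (hd _ _ ?_)
    simp only [Finset.mem_filter, Finset.mem_univ, true_and] at hj
    exact fun h => hj h.symm
  · refine Finset.prod_ne_zero_iff.2 fun p hp => hd _ _ ?_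
    simp only [Finset.mem_filter, Finset.mem_univ, true_and] at hp
    exact hp.1.ne

theorem kernel_trivial (α : Fin 8 → K) (i : Fin 8) (h : (Nmat α i).det ≠ 0)
    (c : Fin 10 → K) (hc : (Mmat α i).mulVec c = 0) : c = 0 := by
  refine Matrix.eq_zero_of_mulVec_eq_zero h ?_
  ext r
  have := congrFun hc r.castSucc
  have hrow : Mmat α i r.castSucc = Nmat α i r := by
    funext k
    simp only [Mmat, Nmat, Matrix.of_apply, Fin.val_castSucc]
    split_ifs <;> first | rfl | omega
  simpa [Matrix.mulVec, hrow] using this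

end Helpers

/-- Let `α₁, …, α₈` be a normal basis of `𝔽_{q⁸}` over `𝔽_q` and `P_i = [1 : α_i : α_i³]`.
For each `i`, the determinant of the 10×10 matrix obtained from the singularity-condition
matrix `M_i` by removing its last row equals
`± α_i³ (2α_i + ∑_{j≠i} α_j) ∏_{j≠i} (α_i − α_j)² ∏_{k<j, k,j≠i} (α_k − α_j)`, which is
nonzero; hence `M_i` has trivial kernel and no plane cubic through all eight points
`P₁, …, P₈` is singular at `P_i`. -/
theorem cubic_singularity_matrix_det {F K : Type*} [Field F] [Fintype F]
    [Field K] [Algebra F K]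
    (α : Fin 8 → K)
    (hfrob : ∀ j : Fin 8, α (j + 1) = α j ^ Fintype.card F)
    (hbasis : LinearIndependent F α)
    (i : Fin 8) :
    ((Nmat α i).det = detExpr α i ∨ (Nmat α i).det = - detExpr α i) ∧
    detExpr α i ≠ 0 ∧
    (∀ c : Fin 10 → K, (Mmat α i).mulVec c = 0 → c = 0) ∧
    ¬ ∃ Γ : MvPolynomial (Fin 3) K, Γ.IsHomogeneous 3 ∧ Γ ≠ 0 ∧
        (∀ j : Fin 8, MvPolynomial.eval ![1, α j, α j ^ 3] Γ = 0) ∧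
        (∀ m : Fin 3, MvPolynomial.eval ![1, α i, α i ^ 3] (MvPolynomial.pderiv m Γ) = 0) := by
  have hdet := det_N α i
  have hne := detExpr_ne_zero α hbasis i
  have hN : (Nmat α i).det ≠ 0 := by
    rcases hdet with h | h <;> rw [h]
    · exact hne
    · exact neg_ne_zero.2 hne
  have hker := kernel_trivial α i hN
  refine ⟨hdet, hne, hker, ?_⟩
  rintro ⟨Γ, hh, h0, hp, hs⟩
  have hz := hker _ (kernel_of_cubic α i Γ hh hp hs)
  apply h0
  rw [cubic_expand Γ hh]
  refine Finset.sum_eq_zero fun k _ => ?_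
  have := congrFun hz k
  simp only [Pi.zero_apply] at this
  rw [this, MvPolynomial.monomial_zero]
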